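/- Let X ⊂ P³ be a nonsingular quartic surface over an algebraically closed field of characteristic 2. Then two disjoint lines l₁, l₂ ⊂ X can simultaneously meet at most 8 other lines on X; i.e., the configuration of lines contains no complete bipartite subgraph K_{10,2} with the two lines on the size-2 side. -/

import Mathlib

open MvPolynomial

/-- The lines (2-dimensional subspaces of `k⁴`) on the quartic `{F = 0}` that meet
both `l₁` and `l₂` and differ from them. -/
def meetingLines {k : Type*} [Field k] (F : MvPolynomial (Fin 4) k)
    (l₁ l₂ : Submodule k (Fin 4 → k)) : Set (Submodule k (Fin 4 → k)) :=
  {W | Module.finrank k W = 2 ∧ (∀ v ∈ W, eval v F = 0) ∧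
    W ⊓ l₁ ≠ ⊥ ∧ W ⊓ l₂ ≠ ⊥ ∧ W ≠ l₁ ∧ W ≠ l₂}

set_option linter.unusedSimpArgs false

theorem quartic_expand {k : Type*} [Field k] (G : MvPolynomial (Fin 4) k) (hG : G.IsHomogeneous 4) :
  ∃ c : (Fin 4 → ℕ) → k, G = ∑ t ∈ Finset.Nat.antidiagonalTuple 4 4, C (c t) * (X 0 ^ t 0 * X 1 ^ t 1 * X 2 ^ t 2 * X 3 ^ t 3) := by
  refine ⟨fun t => coeff (Finsupp.equivFunOnFinite.symm t) G, ?_⟩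
  have key : ∀ t : Fin 4 → ℕ, C (coeff (Finsupp.equivFunOnFinite.symm t) G) * (X 0 ^ t 0 * X 1 ^ t 1 * X 2 ^ t 2 * X 3 ^ t 3) = monomial (Finsupp.equivFunOnFinite.symm t) (coeff (Finsupp.equivFunOnFinite.symm t) G) := by
    intro t
    rw [MvPolynomial.monomial_eq]
    congr 1
    rw [Finsupp.prod_fintype _ _ (by simp)]
    simp [Fin.prod_univ_four]
  simp only [key]
  ext m
  rw [coeff_sum]
  simp only [coeff_monomial]
  by_cases hm : coeff m G = 0
  · rw [hm, Finset.sum_eq_zero]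
    intro t ht
    split_ifs with h
    · rw [h, hm]
    · rfl
  · have hd := hG hm
    rw [Finset.sum_eq_single (m : Fin 4 → ℕ)]
    · simp
    · intro t _ hne
      rw [if_neg]
      rintro rfl
      simp at hne
    · intro h
      exfalso; apply h
      rw [Finset.Nat.mem_antidiagonalTuple]
      rw [Finsupp.weight_apply, Finsupp.sum_fintype _ _ (by simp)] at hd
      simpa using hd

theorem sum_tuples {M : Type*} [AddCommMonoid M] (f : (Fin 4 → ℕ) → M) :
    ∑ t ∈ Finset.Nat.antidiagonalTuple 4 4, f t =
      f ![0,0,0,4] + f ![0,0,1,3] + f ![0,0,2,2] + f ![0,0,3,1] + f ![0,0,4,0] + f ![0,1,0,3] + f ![0,1,1,2] + f ![0,1,2,1] + f ![0,1,3,0] + f ![0,2,0,2] + f ![0,2,1,1] + f ![0,2,2,0] + f ![0,3,0,1] + f ![0,3,1,0] + f ![0,4,0,0] + f ![1,0,0,3] + f ![1,0,1,2] + f ![1,0,2,1] + f ![1,0,3,0] + f ![1,1,0,2] + f ![1,1,1,1] + f ![1,1,2,0] + f ![1,2,0,1] + f ![1,2,1,0] + f ![1,3,0,0] + f ![2,0,0,2]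 + f ![2,0,1,1] + f ![2,0,2,0] + f ![2,1,0,1] + f ![2,1,1,0] + f ![2,2,0,0] + f ![3,0,0,1] + f ![3,0,1,0] + f ![3,1,0,0] + f ![4,0,0,0] := by
  have h : ∑ t ∈ Finset.Nat.antidiagonalTuple 4 4, f t =
     (List.map f [![0,0,0,4], ![0,0,1,3], ![0,0,2,2], ![0,0,3,1], ![0,0,4,0], ![0,1,0,3], ![0,1,1,2], ![0,1,2,1], ![0,1,3,0], ![0,2,0,2], ![0,2,1,1], ![0,2,2,0], ![0,3,0,1], ![0,3,1,0], ![0,4,0,0], ![1,0,0,3], ![1,0,1,2], ![1,0,2,1], ![1,0,3,0], ![1,1,0,2], ![1,1,1,1], ![1,1,2,0], ![1,2,0,1], ![1,2,1,0], ![1,3,0,0], ![2,0,0,2], ![2,0,1,1], ![2,0,2,0], ![2,1,0,1], ![2,1,1,0], ![2,2,0,0], ![3,0,0,1], ![3,0,1,0], ![3,1,0,0], ![4,0,0,0]]).sum := rfl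
  rw [h]
  simp only [List.map_cons, List.map_nil, List.sum_cons, List.sum_nil, add_zero, add_assoc]

def cub {k : Type*} [Field k] (p : ℕ → k) (x y : k) : k :=
  p 0 * x ^ 3 + p 1 * x ^ 2 * y + p 2 * x * y ^ 2 + p 3 * y ^ 3

def quad {k : Type*} [Field k] (p : ℕ → k) (x y : k) : k :=
  p 0 * x ^ 2 + p 1 * x * y + p 2 * y ^ 2

theorem quartic_form {k : Type*} [Field k] [Infinite k] (G : MvPolynomial (Fin 4) k) (hG : G.IsHomogeneous 4)
    (h1 : ∀ x y, eval ![x, y, 0, 0] G = 0) (h2 : ∀ z w, eval ![0, 0, z, w] G = 0) :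
    ∃ p q r s e f g : ℕ → k,
      (∀ x y z w, eval ![x, y, z, w] G = z * cub p x y + w * cub q x y + x * cub r z w + y * cub s z w
        + z ^ 2 * quad e x y + z * w * quad f x y + w ^ 2 * quad g x y) ∧
      (∀ x y z w, eval ![x, y, z, w] (pderiv 0 G) =
        z * (3 * p 0 * x ^ 2 + 2 * p 1 * x * y + p 2 * y ^ 2) +
        w * (3 * q 0 * x ^ 2 + 2 * q 1 * x * y + q 2 * y ^ 2) + cub r z w +
        z ^ 2 * (2 * e 0 * x + e 1 * y) + z * w * (2 * f 0 * x + f 1 * y) + w ^ 2 * (2 * g 0 * x + g 1 * y)) ∧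
      (∀ x y z w, eval ![x, y, z, w] (pderiv 1 G) =
        z * (p 1 * x ^ 2 + 2 * p 2 * x * y + 3 * p 3 * y ^ 2) +
        w * (q 1 * x ^ 2 + 2 * q 2 * x * y + 3 * q 3 * y ^ 2) + cub s z w +
        z ^ 2 * (e 1 * x + 2 * e 2 * y) + z * w * (f 1 * x + 2 * f 2 * y) + w ^ 2 * (g 1 * x + 2 * g 2 * y)) ∧
      (∀ x y z w, eval ![x, y, z, w] (pderiv 2 G) =
        cub p x y + x * (3 * r 0 * z ^ 2 + 2 * r 1 * z * w + r 2 * w ^ 2) +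
        y * (3 * s 0 * z ^ 2 + 2 * s 1 * z * w + s 2 * w ^ 2) +
        2 * z * quad e x y + w * quad f x y) ∧
      (∀ x y z w, eval ![x, y, z, w] (pderiv 3 G) =
        cub q x y + x * (r 1 * z ^ 2 + 2 * r 2 * z * w + 3 * r 3 * w ^ 2) +
        y * (s 1 * z ^ 2 + 2 * s 2 * z * w + 3 * s 3 * w ^ 2) +
        z * quad f x y + 2 * w * quad g x y) := by
  obtain ⟨c, hc⟩ := quartic_expand G hG
  rw [sum_tuples] at hc
  simp at hc
  have e1 : ∀ x y, eval ![x, y, 0, 0] G = c ![4,0,0,0] * x ^ 4 + c ![3,1,0,0] * (x ^ 3 * y) +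
      c ![2,2,0,0] * (x ^ 2 * y ^ 2) + c ![1,3,0,0] * (x * y ^ 3) + c ![0,4,0,0] * y ^ 4 := by
    intro x y; rw [hc]; simp; ring
  have e2 : ∀ x y, eval ![0, 0, x, y] G = c ![0,0,4,0] * x ^ 4 + c ![0,0,3,1] * (x ^ 3 * y) +
      c ![0,0,2,2] * (x ^ 2 * y ^ 2) + c ![0,0,1,3] * (x * y ^ 3) + c ![0,0,0,4] * y ^ 4 := by
    intro x y; rw [hc]; simp; ring
  have van : ∀ a b c d e : k, (∀ x y, a * x ^ 4 + b * (x ^ 3 * y) + c * (x ^ 2 * y ^ 2) + d * (x * y ^ 3) + e * y ^ 4 = 0) →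
      a = 0 ∧ b = 0 ∧ c = 0 ∧ d = 0 ∧ e = 0 := by
    intro a b c d e h
    have hp : (Polynomial.C a * Polynomial.X ^ 4 + Polynomial.C b * Polynomial.X ^ 3 + Polynomial.C c * Polynomial.X ^ 2
      + Polynomial.C d * Polynomial.X + Polynomial.C e) = 0 := by
      apply Polynomial.funext
      intro x
      have := h x 1
      simp
      linear_combination this
    have hh : ∀ n, Polynomial.coeff (Polynomial.C a * Polynomial.X ^ 4 + Polynomial.C b * Polynomial.X ^ 3 + Polynomial.C c * Polynomial.X ^ 2
      + Polynomial.C d * Polynomial.X + Polynomial.C e) n = 0 := by rw [hp]; simp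
    have h0 := hh 0
    have h1 := hh 1
    have h2 := hh 2
    have h3 := hh 3
    have h4 := hh 4
    simp [Polynomial.coeff_X, Polynomial.coeff_C, Polynomial.coeff_X_pow] at h0 h1 h2 h3 h4
    exact ⟨h4, h3, h2, h1, h0⟩
  obtain ⟨a1, a2, a3, a4, a5⟩ := van _ _ _ _ _ (fun x y => (e1 x y).symm.trans (h1 x y))
  obtain ⟨b1, b2, b3, b4, b5⟩ := van _ _ _ _ _ (fun x y => (e2 x y).symm.trans (h2 x y))
  rw [a1, a2, a3, a4, a5, b1, b2, b3, b4, b5] at hc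
  simp only [C_0, zero_mul, add_zero, zero_add] at hc
  clear e1 e2 h1 h2 van hG a1 a2 a3 a4 a5 b1 b2 b3 b4 b5
  refine ⟨fun i => c ![3 - i, i, 1, 0], fun i => c ![3 - i, i, 0, 1], fun i => c ![1, 0, 3 - i, i],
    fun i => c ![0, 1, 3 - i, i], fun i => c ![2 - i, i, 2, 0], fun i => c ![2 - i, i, 1, 1],
    fun i => c ![2 - i, i, 0, 2], ?_, ?_, ?_, ?_, ?_⟩
  all_goals
    intro x y z w
    rw [hc]
    simp [cub, quad, pderiv_X, Derivation.leibniz, Derivation.leibniz_pow]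
    ring

/-- binary forms of degree `n`, as functions -/
def IsForm {k : Type*} [Field k] (n : ℕ) (f : k → k → k) : Prop :=
  ∃ P : MvPolynomial (Fin 2) k, P.IsHomogeneous n ∧ ∀ x y, eval ![x, y] P = f x y

namespace IsForm
variable {k : Type*} [Field k]

theorem add {n : ℕ} {f g : k → k → k} (hf : IsForm n f) (hg : IsForm n g) :
    IsForm n (fun x y => f x y + g x y) := by
  obtain ⟨P, hP, hf⟩ := hf
  obtain ⟨Q, hQ, hg⟩ := hg
  exact ⟨P + Q, hP.add hQ, fun x y => by simp [hf, hg]⟩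

theorem mul {m n : ℕ} {f g : k → k → k} (hf : IsForm m f) (hg : IsForm n g) :
    IsForm (m + n) (fun x y => f x y * g x y) := by
  obtain ⟨P, hP, hf⟩ := hf
  obtain ⟨Q, hQ, hg⟩ := hg
  exact ⟨P * Q, hP.mul hQ, fun x y => by simp [hf, hg]⟩

theorem pow {m : ℕ} {f : k → k → k} (hf : IsForm m f) (n : ℕ) :
    IsForm (m * n) (fun x y => f x y ^ n) := by
  obtain ⟨P, hP, hf⟩ := hf
  exact ⟨P ^ n, hP.pow n, fun x y => by simp [hf]⟩

theorem const (c : k) : IsForm 0 (fun _ _ => c) :=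
  ⟨C c, isHomogeneous_C _ c, fun x y => by simp⟩

theorem fst : IsForm 1 (fun x _ : k => x) :=
  ⟨X 0, isHomogeneous_X _ 0, fun x y => by simp⟩

theorem snd : IsForm 1 (fun _ y : k => y) :=
  ⟨X 1, isHomogeneous_X _ 1, fun x y => by simp⟩

theorem cast {m n : ℕ} {f : k → k → k} (hf : IsForm m f) (h : m = n) : IsForm n f := h ▸ hf

theorem expand {n : ℕ} {f : k → k → k} (hf : IsForm n f) :
    ∃ c : ℕ → k, ∀ x y, f x y = ∑ i ∈ Finset.range (n + 1), c i * x ^ (n - i) * y ^ i := by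
  obtain ⟨P, hP, hf⟩ := hf
  let m : ℕ → (Fin 2 →₀ ℕ) := fun i => Finsupp.equivFunOnFinite.symm ![n - i, i]
  refine ⟨fun i => coeff (m i) P, fun x y => ?_⟩
  rw [← hf, eval_eq']
  have hsub : P.support ⊆ (Finset.range (n + 1)).image m := by
    intro d hd
    have := hP (mem_support_iff.mp hd)
    rw [Finsupp.weight_apply, Finsupp.sum_fintype _ _ (by simp)] at this
    simp at this
    rw [Finset.mem_image]
    refine ⟨d 1, by simp; omega, ?_⟩
    ext i
    fin_cases i
    · simp [m]; omega
    · simp [m]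
  rw [Finset.sum_subset hsub]
  · rw [Finset.sum_image]
    · apply Finset.sum_congr rfl
      intro i _
      simp [m, Fin.prod_univ_two, mul_assoc]
    · intro i _ j _ hij
      have := DFunLike.congr_fun hij 1
      simpa [m] using this
  · intro d _ hd
    simp at hd
    simp [hd]

/-- two forms proportional to a vector of squares have a common zero -/
theorem no_root [IsAlgClosed k] {n : ℕ} {f : k → k → k} (hf : IsForm n f) (h : ∀ y, f 1 y ≠ 0) :
    ∃ c, ∀ x, f x 1 = c * x ^ n := by
  obtain ⟨c, hc⟩ := hf.expand
  let p : Polynomial k := ∑ i ∈ Finset.range (n + 1), Polynomial.C (c i) * Polynomial.X ^ i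
  have hp : ∀ y, p.eval y = f 1 y := by
    intro y
    simp [p, hc, Polynomial.eval_finsetSum]
  have hdeg : p.degree = 0 := by
    by_contra hd
    obtain ⟨y, hy⟩ := IsAlgClosed.exists_root p hd
    exact h y (by rw [← hp]; exact hy)
  have hcoef : ∀ i, 0 < i → i < n + 1 → c i = 0 := by
    intro i hi hi2
    have : p.coeff i = 0 := by
      rw [Polynomial.eq_C_of_degree_eq_zero hdeg, Polynomial.coeff_C, if_neg (by omega)]
    simpa [p, Polynomial.finsetSum_coeff, Polynomial.coeff_X_pow, hi2] using this
  refine ⟨c 0, fun x => ?_⟩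
  rw [hc, Finset.sum_eq_single 0]
  · simp
  · intro i hi hi0
    rw [hcoef i (by omega) (Finset.mem_range.mp hi)]
    simp
  · simp

theorem exists_root [IsAlgClosed k] {n : ℕ} {f : k → k → k} (hn : n ≠ 0) (hf : IsForm n f) :
    ∃ x y, (x ≠ 0 ∨ y ≠ 0) ∧ f x y = 0 := by
  by_cases h : ∀ y, f 1 y ≠ 0
  · obtain ⟨c, hc⟩ := hf.no_root h
    exact ⟨0, 1, by simp, by simp [hc, hn]⟩
  · push Not at h
    obtain ⟨y, hy⟩ := h
    exact ⟨1, y, by simp, hy⟩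

/-- single-variable polynomial of a form -/
theorem poly_right {n : ℕ} {f : k → k → k} (hf : IsForm n f) :
    ∃ p : Polynomial k, ∀ x, p.eval x = f x 1 := by
  obtain ⟨c, hc⟩ := hf.expand
  exact ⟨∑ i ∈ Finset.range (n + 1), Polynomial.C (c i) * Polynomial.X ^ (n - i), fun x => by
    simp [hc, Polynomial.eval_finsetSum]⟩

theorem common_root_sq [IsAlgClosed k] {n : ℕ} {f g : k → k → k} (hf : IsForm (n + 3) f)
    (hg : IsForm (n + 3) g) (hrel : ∀ x y, x ^ 2 * f x y + y ^ 2 * g x y = 0) :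
    ∃ x y, (x ≠ 0 ∨ y ≠ 0) ∧ f x y = 0 ∧ g x y = 0 := by
  by_cases h : ∀ y, g 1 y ≠ 0
  · obtain ⟨c, hc⟩ := hg.no_root h
    obtain ⟨p, hp⟩ := hf.poly_right
    have hpe : Polynomial.X ^ 2 * p = Polynomial.X ^ 2 * (- Polynomial.C c * Polynomial.X ^ (n + 1)) := by
      apply Polynomial.funext
      intro x
      have := hrel x 1
      simp [hp]
      rw [hc] at this
      linear_combination this
    have hpe2 := mul_left_cancel₀ (by simp) hpe
    refine ⟨0, 1, by simp, ?_, by simp [hc]⟩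
    rw [← hp, hpe2]; simp
  · push Not at h
    obtain ⟨y, hy⟩ := h
    refine ⟨1, y, by simp, ?_, hy⟩
    have := hrel 1 y
    simpa [hy] using this

theorem common_root_const [IsAlgClosed k] {n : ℕ} (hn : n ≠ 0) {f g : k → k → k} (hf : IsForm n f)
    (hg : IsForm n g) {a b : k} (hab : a ≠ 0 ∨ b ≠ 0) (hrel : ∀ x y, a * f x y + b * g x y = 0) :
    ∃ x y, (x ≠ 0 ∨ y ≠ 0) ∧ f x y = 0 ∧ g x y = 0 := by
  rcases hab with h | h
  · obtain ⟨x, y, hxy, h0⟩ := hg.exists_root hn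
    refine ⟨x, y, hxy, ?_, h0⟩
    have := hrel x y
    simpa [h0, h] using this
  · obtain ⟨x, y, hxy, h0⟩ := hf.exists_root hn
    refine ⟨x, y, hxy, h0, ?_⟩
    have := hrel x y
    simpa [h0, h] using this

theorem root_count {n : ℕ} {f : k → k → k} (hf : IsForm n f) (hne : ∃ x y, f x y ≠ 0) :
    ∃ S : Finset (k × k), S.card ≤ n ∧ ∀ x y, (x ≠ 0 ∨ y ≠ 0) → f x y = 0 →
      ∃ t ∈ S, ∃ c : k, c ≠ 0 ∧ x = c * t.1 ∧ y = c * t.2 := by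
  classical
  obtain ⟨c, hc⟩ := hf.expand
  let p : Polynomial k := ∑ i ∈ Finset.range (n + 1), Polynomial.C (c i) * Polynomial.X ^ i
  have hp : ∀ x y, x ≠ 0 → f x y = x ^ n * p.eval (y / x) := by
    intro x y hx
    simp only [p, hc, Polynomial.eval_finsetSum, Finset.mul_sum]
    apply Finset.sum_congr rfl
    intro i hi
    have : x ^ n = x ^ (n - i) * x ^ i := by
      rw [← pow_add, Nat.sub_add_cancel (by have := Finset.mem_range.mp hi; omega)]
    simp only [Polynomial.eval_mul, Polynomial.eval_C, Polynomial.eval_pow, Polynomial.eval_X]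
    rw [div_pow, this]
    field_simp
  have hcoef : ∀ i, i < n + 1 → p.coeff i = c i := by
    intro i hi
    simp [p, Polynomial.finsetSum_coeff, Polynomial.coeff_X_pow, hi]
  have hdeg : p.natDegree ≤ n := by
    apply Polynomial.natDegree_sum_le_of_forall_le
    intro i hi
    refine (Polynomial.natDegree_C_mul_X_pow_le _ _).trans ?_
    have := Finset.mem_range.mp hi; omega
  have hp0 : p ≠ 0 := by
    intro h0
    obtain ⟨x, y, hxy⟩ := hne
    apply hxy
    rw [hc]
    apply Finset.sum_eq_zero
    intro i hi
    rw [← hcoef i (Finset.mem_range.mp hi), h0]; simp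
  have h0y : ∀ y, f 0 y = c n * y ^ n := by
    intro y
    rw [hc, Finset.sum_eq_single n]
    · simp
    · intro i hi hi0
      have := Finset.mem_range.mp hi
      rw [zero_pow (by omega)]; simp
    · simp
  let S₀ : Finset (k × k) := p.roots.toFinset.image (fun y => ((1 : k), y))
  have hS₀ : S₀.card ≤ p.natDegree :=
    Finset.card_image_le.trans ((Multiset.toFinset_card_le _).trans (Polynomial.card_roots' p))
  have hmem : ∀ x y, x ≠ 0 → f x y = 0 → ∃ t ∈ S₀, ∃ c : k, c ≠ 0 ∧ x = c * t.1 ∧ y = c * t.2 := by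
    intro x y hx h
    refine ⟨(1, y / x), ?_, x, hx, by simp, by field_simp⟩
    simp only [S₀, Finset.mem_image, Multiset.mem_toFinset]
    refine ⟨y / x, ?_, rfl⟩
    rw [Polynomial.mem_roots hp0, Polynomial.IsRoot]
    rw [hp x y hx] at h
    simpa [hx] using h
  by_cases hcn : c n = 0
  · refine ⟨insert (0, 1) S₀, ?_, ?_⟩
    · refine (Finset.card_insert_le _ _).trans ?_
      have : p.natDegree ≠ n := by
        intro h
        have h2 : p.leadingCoeff = 0 := by
          rw [Polynomial.leadingCoeff, h, hcoef n (by omega), hcn]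
        exact hp0 (Polynomial.leadingCoeff_eq_zero.mp h2)
      omega
    · intro x y hxy h
      by_cases hx : x = 0
      · refine ⟨(0, 1), by simp, y, ?_, by simp [hx], by simp⟩
        simpa [hx] using hxy
      · obtain ⟨t, ht, h⟩ := hmem x y hx h
        exact ⟨t, by simp [ht], h⟩
  · refine ⟨S₀, hS₀.trans hdeg, ?_⟩
    intro x y hxy h
    by_cases hx : x = 0
    · subst hx
      rw [h0y] at h
      simp [hcn] at h
      simp [h] at hxy
    · exact hmem x y hx h

end IsForm

theorem IsForm.cub {k : Type*} [Field k] (p : ℕ → k) {n : ℕ} {f g : k → k → k} (hf : IsForm n f)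
    (hg : IsForm n g) : IsForm (n * 3) (fun x y => _root_.cub p (f x y) (g x y)) := by
  unfold _root_.cub
  refine IsForm.add (IsForm.add (IsForm.add ?_ ?_) ?_) ?_
  · exact ((const _).mul (hf.pow 3)).cast (by omega)
  · exact (((const _).mul (hf.pow 2)).mul hg).cast (by omega)
  · exact (((const _).mul hf).mul (hg.pow 2)).cast (by omega)
  · exact ((const _).mul (hg.pow 3)).cast (by omega)

theorem IsForm.quad {k : Type*} [Field k] (p : ℕ → k) {n : ℕ} {f g : k → k → k} (hf : IsForm n f)
    (hg : IsForm n g) : IsForm (n * 2) (fun x y => _root_.quad p (f x y) (g x y)) := by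
  unfold _root_.quad
  refine IsForm.add (IsForm.add ?_ ?_) ?_
  · exact ((const _).mul (hf.pow 2)).cast (by omega)
  · exact (((const _).mul hf).mul hg).cast (by omega)
  · exact ((const _).mul (hg.pow 2)).cast (by omega)

set_option maxHeartbeats 4000000 in
theorem sing_point {k : Type*} [Field k] [IsAlgClosed k] [CharP k 2] (p q r s : ℕ → k) :
    ∃ x y z w : k, (x ≠ 0 ∨ y ≠ 0 ∨ z ≠ 0 ∨ w ≠ 0) ∧
      z * (p 0 * x ^ 2 + p 2 * y ^ 2) + w * (q 0 * x ^ 2 + q 2 * y ^ 2) + cub r z w = 0 ∧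
      z * (p 1 * x ^ 2 + p 3 * y ^ 2) + w * (q 1 * x ^ 2 + q 3 * y ^ 2) + cub s z w = 0 ∧
      cub p x y + x * (r 0 * z ^ 2 + r 2 * w ^ 2) + y * (s 0 * z ^ 2 + s 2 * w ^ 2) = 0 ∧
      cub q x y + x * (r 1 * z ^ 2 + r 3 * w ^ 2) + y * (s 1 * z ^ 2 + s 3 * w ^ 2) = 0 := by
  have h2 : (2 : k) = 0 := CharTwo.two_eq_zero
  have hsq : ∀ a : k, ∃ b, b ^ 2 = a := fun a => IsAlgClosed.exists_pow_nat_eq a (by norm_num)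
  choose σ hσ using hsq
  let α : k → k → k := fun u v => σ (p 0) * u + σ (q 0) * v
  let β : k → k → k := fun u v => σ (p 1) * u + σ (q 1) * v
  let γ : k → k → k := fun u v => σ (p 2) * u + σ (q 2) * v
  let δ : k → k → k := fun u v => σ (p 3) * u + σ (q 3) * v
  let d0 : k → k → k := fun u v => cub (fun i => σ (r i)) u v
  let d1 : k → k → k := fun u v => cub (fun i => σ (s i)) u v
  let A : k → k → k := fun u v => δ u v * d0 u v + γ u v * d1 u v
  let B : k → k → k := fun u v => β u v * d0 u v + α u v * d1 u v
  let t : k → k → k := fun u v => α u v * δ u v + β u v * γ u v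
  let X0 : k → k → k := fun u v => cub p (A u v) (B u v) + t u v ^ 2 *
    (A u v * (r 0 * u ^ 4 + r 2 * v ^ 4) + B u v * (s 0 * u ^ 4 + s 2 * v ^ 4))
  let X1 : k → k → k := fun u v => cub q (A u v) (B u v) + t u v ^ 2 *
    (A u v * (r 1 * u ^ 4 + r 3 * v ^ 4) + B u v * (s 1 * u ^ 4 + s 3 * v ^ 4))
  have hα : ∀ u v, α u v ^ 2 = p 0 * u ^ 2 + q 0 * v ^ 2 := fun u v => by
    simp only [α, CharTwo.add_sq, mul_pow, hσ]
  have hβ : ∀ u v, β u v ^ 2 = p 1 * u ^ 2 + q 1 * v ^ 2 := fun u v => by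
    simp only [β, CharTwo.add_sq, mul_pow, hσ]
  have hγ : ∀ u v, γ u v ^ 2 = p 2 * u ^ 2 + q 2 * v ^ 2 := fun u v => by
    simp only [γ, CharTwo.add_sq, mul_pow, hσ]
  have hδ : ∀ u v, δ u v ^ 2 = p 3 * u ^ 2 + q 3 * v ^ 2 := fun u v => by
    simp only [δ, CharTwo.add_sq, mul_pow, hσ]
  have hd0 : ∀ u v, d0 u v ^ 2 = cub r (u ^ 2) (v ^ 2) := fun u v => by
    simp only [d0, cub, CharTwo.add_sq, mul_pow, hσ]; ring
  have hd1 : ∀ u v, d1 u v ^ 2 = cub s (u ^ 2) (v ^ 2) := fun u v => by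
    simp only [d1, cub, CharTwo.add_sq, mul_pow, hσ]; ring
  have hA : ∀ u v, A u v ^ 2 = δ u v ^ 2 * d0 u v ^ 2 + γ u v ^ 2 * d1 u v ^ 2 := fun u v => by
    simp only [A, CharTwo.add_sq, mul_pow]
  have hB : ∀ u v, B u v ^ 2 = β u v ^ 2 * d0 u v ^ 2 + α u v ^ 2 * d1 u v ^ 2 := fun u v => by
    simp only [B, CharTwo.add_sq, mul_pow]
  have ht : ∀ u v, t u v ^ 2 = α u v ^ 2 * δ u v ^ 2 + β u v ^ 2 * γ u v ^ 2 := fun u v => by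
    simp only [t, CharTwo.add_sq, mul_pow]
  have hM0 : ∀ u v, α u v ^ 2 * A u v ^ 2 + γ u v ^ 2 * B u v ^ 2 + t u v ^ 2 * d0 u v ^ 2 = 0 := by
    intro u v
    rw [hA, hB, ht]
    linear_combination (α u v ^ 2 * δ u v ^ 2 * d0 u v ^ 2 + γ u v ^ 2 * β u v ^ 2 * d0 u v ^ 2 +
      γ u v ^ 2 * α u v ^ 2 * d1 u v ^ 2) * h2
  have hM1 : ∀ u v, β u v ^ 2 * A u v ^ 2 + δ u v ^ 2 * B u v ^ 2 + t u v ^ 2 * d1 u v ^ 2 = 0 := by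
    intro u v
    rw [hA, hB, ht]
    linear_combination (β u v ^ 2 * δ u v ^ 2 * d0 u v ^ 2 + γ u v ^ 2 * β u v ^ 2 * d1 u v ^ 2 +
      δ u v ^ 2 * α u v ^ 2 * d1 u v ^ 2) * h2
  have hrel : ∀ u v, u ^ 2 * X0 u v + v ^ 2 * X1 u v = 0 := by
    intro u v
    have e0 := hM0 u v
    have e1 := hM1 u v
    rw [hα, hγ, hd0] at e0
    rw [hβ, hδ, hd1] at e1
    simp only [X0, X1]
    simp only [cub] at e0 e1 ⊢
    linear_combination A u v * e0 + B u v * e1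
  have lin : ∀ a b : k, IsForm 1 (fun u v => a * u + b * v) := fun a b =>
    (((IsForm.const a).mul IsForm.fst).cast (by norm_num)).add
      (((IsForm.const b).mul IsForm.snd).cast (by norm_num))
  have p4 : ∀ a b : k, IsForm 4 (fun u v => a * u ^ 4 + b * v ^ 4) := fun a b =>
    (((IsForm.const a).mul (IsForm.fst.pow 4)).cast (by norm_num)).add
      (((IsForm.const b).mul (IsForm.snd.pow 4)).cast (by norm_num))
  have fd0 : IsForm 3 d0 := IsForm.cub _ IsForm.fst IsForm.snd
  have fd1 : IsForm 3 d1 := IsForm.cub _ IsForm.fst IsForm.snd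
  have fA : IsForm 4 A := ((lin _ _).mul fd0).add ((lin _ _).mul fd1)
  have fB : IsForm 4 B := ((lin _ _).mul fd0).add ((lin _ _).mul fd1)
  have ft : IsForm 2 t := ((lin _ _).mul (lin _ _)).add ((lin _ _).mul (lin _ _))
  have fX0 : IsForm (9 + 3) X0 := (fA.cub p fB).add ((ft.pow 2).mul ((fA.mul (p4 _ _)).add (fB.mul (p4 _ _))))
  have fX1 : IsForm (9 + 3) X1 := (fA.cub q fB).add ((ft.pow 2).mul ((fA.mul (p4 _ _)).add (fB.mul (p4 _ _))))
  obtain ⟨u, v, huv, h0, h1⟩ := IsForm.common_root_sq fX0 fX1 hrel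
  by_cases hAB : A u v = 0 ∧ B u v = 0
  · have huv2 : u ^ 2 ≠ 0 ∨ v ^ 2 ≠ 0 := by simpa using huv
    by_cases hd : cub r (u ^ 2) (v ^ 2) = 0 ∧ cub s (u ^ 2) (v ^ 2) = 0
    · refine ⟨0, 0, u ^ 2, v ^ 2, ?_, ?_, ?_, ?_, ?_⟩
      · exact Or.inr (Or.inr huv2)
      · rw [hd.1]; ring
      · rw [hd.2]; ring
      · simp [cub]
      · simp [cub]
    · -- the columns of the matrix are proportional to (d0, d1)
      have prop : ∃ l m : k, α u v = l * d0 u v ∧ β u v = l * d1 u v ∧ γ u v = m * d0 u v ∧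
          δ u v = m * d1 u v := by
        have hd' : d0 u v ≠ 0 ∨ d1 u v ≠ 0 := by
          by_contra hcon
          push Not at hcon
          apply hd
          rw [← hd0, ← hd1, hcon.1, hcon.2]; simp
        have hA0 : δ u v * d0 u v + γ u v * d1 u v = 0 := hAB.1
        have hB0 : β u v * d0 u v + α u v * d1 u v = 0 := hAB.2
        rcases hd' with hd' | hd'
        · refine ⟨α u v / d0 u v, γ u v / d0 u v, by field_simp, ?_, by field_simp, ?_⟩
          · field_simp
            linear_combination hB0 - α u v * d1 u v * h2
          · field_simp
            linear_combination hA0 - γ u v * d1 u v * h2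
        · refine ⟨β u v / d1 u v, δ u v / d1 u v, ?_, by field_simp, ?_, by field_simp⟩
          · field_simp
            linear_combination hB0 - β u v * d0 u v * h2
          · field_simp
            linear_combination hA0 - δ u v * d0 u v * h2
      obtain ⟨l, m, ha, hb, hc, hd4⟩ := prop
      have ea := hα u v
      have eb := hβ u v
      have ec := hγ u v
      have ed := hδ u v
      rw [ha, mul_pow, hd0] at ea
      rw [hb, mul_pow, hd1] at eb
      rw [hc, mul_pow, hd0] at ec
      rw [hd4, mul_pow, hd1] at ed
      clear_value α β γ δ d0 d1 A B t X0 X1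
      generalize hz : u ^ 2 = z at *
      generalize hw : v ^ 2 = w at *
      let Y0 : k → k → k := fun x y => cub p x y + (l * x + m * y) ^ 2 *
        ((r 0 * z ^ 2 + r 2 * w ^ 2) * x + (s 0 * z ^ 2 + s 2 * w ^ 2) * y)
      let Y1 : k → k → k := fun x y => cub q x y + (l * x + m * y) ^ 2 *
        ((r 1 * z ^ 2 + r 3 * w ^ 2) * x + (s 1 * z ^ 2 + s 3 * w ^ 2) * y)
      have fY0 : IsForm 3 Y0 := (IsForm.cub p IsForm.fst IsForm.snd).add (((lin _ _).pow 2).mul (lin _ _))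
      have fY1 : IsForm 3 Y1 := (IsForm.cub q IsForm.fst IsForm.snd).add (((lin _ _).pow 2).mul (lin _ _))
      have hlm : ∀ x y : k, (l * x + m * y) ^ 2 = l ^ 2 * x ^ 2 + m ^ 2 * y ^ 2 := fun x y => by
        simp only [CharTwo.add_sq, mul_pow]
      have k0 : ∀ x y, z * (p 0 * x ^ 2 + p 2 * y ^ 2) + w * (q 0 * x ^ 2 + q 2 * y ^ 2) +
          (l * x + m * y) ^ 2 * cub r z w = 0 := by
        intro x y
        rw [hlm]
        linear_combination (-x ^ 2) * ea - y ^ 2 * ec + (l ^ 2 * x ^ 2 + m ^ 2 * y ^ 2) * cub r z w * h2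
      have k1 : ∀ x y, z * (p 1 * x ^ 2 + p 3 * y ^ 2) + w * (q 1 * x ^ 2 + q 3 * y ^ 2) +
          (l * x + m * y) ^ 2 * cub s z w = 0 := by
        intro x y
        rw [hlm]
        linear_combination (-x ^ 2) * eb - y ^ 2 * ed + (l ^ 2 * x ^ 2 + m ^ 2 * y ^ 2) * cub s z w * h2
      have rel : ∀ x y, z * Y0 x y + w * Y1 x y = 0 := by
        intro x y
        have e0 := k0 x y
        have e1 := k1 x y
        simp only [Y0, Y1]
        simp only [cub] at e0 e1 ⊢
        linear_combination x * e0 + y * e1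
      obtain ⟨x, y, hxy, g0, g1⟩ := IsForm.common_root_const (by norm_num) fY0 fY1 huv2 rel
      refine ⟨x, y, (l * x + m * y) * z, (l * x + m * y) * w,
        hxy.elim Or.inl (fun h => Or.inr (Or.inl h)), ?_, ?_, ?_, ?_⟩
      · have e0 := k0 x y
        simp only [cub] at e0 ⊢
        linear_combination (l * x + m * y) * e0
      · have e1 := k1 x y
        simp only [cub] at e1 ⊢
        linear_combination (l * x + m * y) * e1
      · simp only [Y0] at g0
        linear_combination g0
      · simp only [Y1] at g1
        linear_combination g1
  · refine ⟨A u v, B u v, t u v * u ^ 2, t u v * v ^ 2,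
      by by_contra h; push Not at h; exact hAB ⟨h.1, h.2.1⟩, ?_, ?_, ?_, ?_⟩
    · have e0 := hM0 u v
      rw [hα, hγ, hd0] at e0
      simp only [cub] at e0 ⊢
      linear_combination t u v * e0
    · have e1 := hM1 u v
      rw [hβ, hδ, hd1] at e1
      simp only [cub] at e1 ⊢
      linear_combination t u v * e1
    · simp only [X0] at h0
      linear_combination h0
    · simp only [X1] at h1
      linear_combination h1


theorem forms_zero_aux {k : Type*} [Field k] [IsAlgClosed k] (p q e f g : ℕ → k)
    (hpq : ∀ y, cub p 1 y ≠ 0 ∨ cub q 1 y ≠ 0) (hq3 : q 3 ≠ 0)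
    (hG : ∀ y, quad e 1 y * cub q 1 y ^ 2 + quad f 1 y * cub p 1 y * cub q 1 y +
      quad g 1 y * cub p 1 y ^ 2 = 0) :
    (∀ i < 3, e i = 0) ∧ (∀ i < 3, f i = 0) ∧ (∀ i < 3, g i = 0) := by
  let c3 : (ℕ → k) → Polynomial k := fun p => Polynomial.C (p 3) * Polynomial.X ^ 3 +
    Polynomial.C (p 2) * Polynomial.X ^ 2 + Polynomial.C (p 1) * Polynomial.X + Polynomial.C (p 0)
  let c2 : (ℕ → k) → Polynomial k := fun p =>
    Polynomial.C (p 2) * Polynomial.X ^ 2 + Polynomial.C (p 1) * Polynomial.X + Polynomial.C (p 0)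
  have h3 : ∀ p y, (c3 p).eval y = cub p 1 y := fun p y => by simp [c3, cub]; ring
  have h2 : ∀ p y, (c2 p).eval y = quad p 1 y := fun p y => by simp [c2, quad]; ring
  have hcop : IsCoprime (c3 p) (c3 q) := by
    rw [Polynomial.isCoprime_iff_aeval_ne_zero_of_isAlgClosed k k]
    intro y
    simpa [h3] using hpq y
  have hd3 : (c3 q).natDegree = 3 := Polynomial.natDegree_cubic hq3
  have hq0 : c3 q ≠ 0 := by
    intro h; rw [h] at hd3; simp at hd3
  have hd2 : ∀ p, (c2 p).natDegree < (c3 q).natDegree := fun p => by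
    rw [hd3]; exact Nat.lt_succ_of_le Polynomial.natDegree_quadratic_le
  have zero : ∀ p, c2 p = 0 → ∀ i < 3, p i = 0 := by
    intro p hp i hi
    have h0 := congrArg (fun P => Polynomial.coeff P i) hp
    interval_cases i <;> simpa [c2, Polynomial.coeff_X, Polynomial.coeff_C, Polynomial.coeff_X_pow] using h0
  have hP : c2 e * c3 q ^ 2 + c2 f * c3 p * c3 q + c2 g * c3 p ^ 2 = 0 := by
    apply Polynomial.funext
    intro y
    simpa [h3, h2] using hG y
  have hg : c2 g = 0 := by
    apply Polynomial.eq_zero_of_dvd_of_natDegree_lt _ (hd2 g)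
    apply (hcop.symm.pow_right (n := 2)).dvd_of_dvd_mul_right
    exact ⟨-(c2 e * c3 q + c2 f * c3 p), by linear_combination hP⟩
  have hP2 : c2 e * c3 q + c2 f * c3 p = 0 := by
    apply mul_left_cancel₀ hq0
    rw [hg] at hP
    linear_combination hP
  have hf : c2 f = 0 := by
    apply Polynomial.eq_zero_of_dvd_of_natDegree_lt _ (hd2 f)
    apply hcop.symm.dvd_of_dvd_mul_right
    exact ⟨-(c2 e), by linear_combination hP2⟩
  have he : c2 e = 0 := by
    rw [hf] at hP2
    simpa [hq0] using hP2
  exact ⟨zero e he, zero f hf, zero g hg⟩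

theorem forms_zero {k : Type*} [Field k] [IsAlgClosed k] (p q e f g : ℕ → k)
    (hpq : ∀ x y, (x ≠ 0 ∨ y ≠ 0) → cub p x y ≠ 0 ∨ cub q x y ≠ 0)
    (hG : ∀ x y, quad e x y * cub q x y ^ 2 + quad f x y * cub p x y * cub q x y +
      quad g x y * cub p x y ^ 2 = 0) :
    (∀ i < 3, e i = 0) ∧ (∀ i < 3, f i = 0) ∧ (∀ i < 3, g i = 0) := by
  have h01 := hpq 0 1 (by simp)
  simp [cub] at h01
  rcases h01 with h | h
  · obtain ⟨a, b, c⟩ := forms_zero_aux q p g f e (fun y => (hpq 1 y (by simp)).symm) h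
      (fun y => by linear_combination hG 1 y)
    exact ⟨c, b, a⟩
  · exact forms_zero_aux p q e f g (fun y => hpq 1 y (by simp)) h (fun y => hG 1 y)

theorem chain_rule {k : Type*} [Field k] (T : Matrix (Fin 4) (Fin 4) k) (F : MvPolynomial (Fin 4) k) (j : Fin 4) :
    pderiv j (bind₁ (fun i => ∑ l, C (T l i) * X l) F) =
      ∑ i, C (T j i) * bind₁ (fun i => ∑ l, C (T l i) * X l) (pderiv i F) := by
  induction F using MvPolynomial.induction_on with
  | C a => simp
  | add p q hp hq => simp [hp, hq, mul_add, Finset.sum_add_distrib]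
  | mul_X p n hp =>
    simp only [map_mul, Derivation.leibniz, hp, smul_eq_mul, bind₁_X_right, pderiv_X, map_add, mul_add,
      Finset.sum_add_distrib]
    congr 1
    · simp only [map_sum, Derivation.leibniz, pderiv_C, pderiv_X, smul_eq_mul]
      simp [Pi.single_apply, mul_comm]
    · rw [Finset.mul_sum]
      apply Finset.sum_congr rfl
      intro i _
      ring

theorem two_gens {k : Type*} [Field k] (l : Submodule k (Fin 4 → k)) (hl : Module.finrank k l = 2) :
    ∃ a b : Fin 4 → k, a ∈ l ∧ b ∈ l ∧ (∀ x y : k, x • a + y • b = 0 → x = 0 ∧ y = 0) ∧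
      ∀ v ∈ l, ∃ x y : k, v = x • a + y • b := by
  let B := Module.finBasisOfFinrankEq k l hl
  refine ⟨B 0, B 1, (B 0).2, (B 1).2, ?_, ?_⟩
  · intro x y h
    have hB := B.linearIndependent
    rw [Fintype.linearIndependent_iff] at hB
    have := hB ![x, y] (by
      apply Subtype.ext
      simpa [Fin.sum_univ_two] using h)
    exact ⟨this 0, this 1⟩
  · intro v hv
    have := B.sum_repr ⟨v, hv⟩
    refine ⟨B.repr ⟨v, hv⟩ 0, B.repr ⟨v, hv⟩ 1, ?_⟩
    rw [Fin.sum_univ_two] at this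
    exact (congrArg Subtype.val this).symm

theorem eq_span {k : Type*} [Field k] {l₁ l₂ W : Submodule k (Fin 4 → k)} (hdisj : l₁ ⊓ l₂ = ⊥)
    (hW : Module.finrank k W = 2) {a b : Fin 4 → k} (ha : a ∈ l₁) (hb : b ∈ l₂) (ha0 : a ≠ 0) (hb0 : b ≠ 0)
    (haW : a ∈ W) (hbW : b ∈ W) : W = Submodule.span k {a, b} := by
  symm
  have hli : LinearIndependent k ![a, b] := by
    rw [LinearIndependent.pair_iff]
    intro s t h
    have hs : s • a = 0 := by
      have : s • a ∈ l₁ ⊓ l₂ := by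
        refine ⟨l₁.smul_mem _ ha, ?_⟩
        have e : s • a = -(t • b) := eq_neg_of_add_eq_zero_left h
        rw [e]
        exact l₂.neg_mem (l₂.smul_mem _ hb)
      rw [hdisj] at this
      simpa using this
    have ht : t • b = 0 := by simpa [hs] using h
    simp [ha0] at hs
    simp [hb0] at ht
    exact ⟨hs, ht⟩
  apply Submodule.eq_of_le_of_finrank_eq
  · rw [Submodule.span_le]
    rintro x (rfl | rfl)
    · exact haW
    · exact hbW
  · rw [hW]
    have := finrank_span_eq_card hli
    have hr : Set.range ![a, b] = {a, b} := by
      ext v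
      simp [Fin.exists_fin_two, eq_comm, or_comm]
    rw [hr] at this
    simpa using this

set_option maxHeartbeats 2000000 in
/-- on a nonsingular quartic surface `X = {F = 0} ⊂ ℙ³` over an
algebraically closed field of characteristic 2, two disjoint lines `l₁, l₂ ⊂ X` can
simultaneously meet at most 8 other lines of `X` (no `K₁₀,₂` configuration). -/
theorem char_two_no_K102 {k : Type*} [Field k] [IsAlgClosed k] [CharP k 2]
    (F : MvPolynomial (Fin 4) k) (hF : F.IsHomogeneous 4)
    (hsm : ∀ v : Fin 4 → k, v ≠ 0 →
      ¬ (eval v F = 0 ∧ ∀ i, eval v (pderiv i F) = 0))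
    (l₁ l₂ : Submodule k (Fin 4 → k))
    (hl₁ : Module.finrank k l₁ = 2) (hl₂ : Module.finrank k l₂ = 2)
    (hl₁X : ∀ v ∈ l₁, eval v F = 0) (hl₂X : ∀ v ∈ l₂, eval v F = 0)
    (hdisj : l₁ ⊓ l₂ = ⊥) :
    (meetingLines F l₁ l₂).Finite ∧ (meetingLines F l₁ l₂).ncard ≤ 8 := by
  have : Infinite k := IsAlgClosed.instInfinite
  have h2 : (2 : k) = 0 := CharTwo.two_eq_zero
  have h3 : (3 : k) = 1 := by linear_combination h2
  obtain ⟨v0, v1, hv0, hv1, hi1, hs1⟩ := two_gens l₁ hl₁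
  obtain ⟨v2, v3, hv2, hv3, hi2, hs2⟩ := two_gens l₂ hl₂
  let T : Matrix (Fin 4) (Fin 4) k := Matrix.of ![v0, v1, v2, v3]
  have hinj : ∀ x y z w : k, x • v0 + y • v1 + z • v2 + w • v3 = 0 → x = 0 ∧ y = 0 ∧ z = 0 ∧ w = 0 := by
    intro x y z w h
    have hm : x • v0 + y • v1 ∈ l₁ ⊓ l₂ := by
      refine ⟨l₁.add_mem (l₁.smul_mem _ hv0) (l₁.smul_mem _ hv1), ?_⟩
      have e : x • v0 + y • v1 = -(z • v2 + w • v3) := by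
        apply eq_neg_of_add_eq_zero_left
        rw [← h]; abel
      rw [e]
      exact l₂.neg_mem (l₂.add_mem (l₂.smul_mem _ hv2) (l₂.smul_mem _ hv3))
    rw [hdisj, Submodule.mem_bot] at hm
    rw [hm, zero_add] at h
    obtain ⟨a, b⟩ := hi1 _ _ hm
    obtain ⟨c, d⟩ := hi2 _ _ h
    exact ⟨a, b, c, d⟩
  have hT : IsUnit T := by
    rw [← Matrix.linearIndependent_rows_iff_isUnit, Fintype.linearIndependent_iff]
    intro g hg
    have hg' : g 0 • v0 + g 1 • v1 + g 2 • v2 + g 3 • v3 = 0 := by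
      rw [← hg, Fin.sum_univ_four]; rfl
    obtain ⟨a, b, c, d⟩ := hinj _ _ _ _ hg'
    intro i
    match i with
    | 0 => exact a
    | 1 => exact b
    | 2 => exact c
    | 3 => exact d
  have hTinj : ∀ g : Fin 4 → k, (∀ j, ∑ i, T j i * g i = 0) → g = 0 := by
    intro g hg
    apply Matrix.mulVec_injective_iff_isUnit.mpr hT
    rw [Matrix.mulVec_zero]
    funext j
    exact hg j
  let G : MvPolynomial (Fin 4) k := bind₁ (fun i => ∑ l, C (T l i) * X l) F
  have hGhom : G.IsHomogeneous 4 := by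
    have := hF.aeval (fun i => ∑ l, C (T l i) * X l : Fin 4 → MvPolynomial (Fin 4) k) (n := 1)
      (fun i => IsHomogeneous.sum _ _ _ fun l _ => isHomogeneous_C_mul_X _ _)
    simpa using this
  have hbind : ∀ (P : MvPolynomial (Fin 4) k) (x y z w : k),
      eval ![x, y, z, w] (bind₁ (fun i => ∑ l, C (T l i) * X l) P) =
      eval (x • v0 + y • v1 + z • v2 + w • v3) P := by
    intro P x y z w
    rw [← MvPolynomial.coe_aeval_eq_eval, ← MvPolynomial.coe_aeval_eq_eval]
    simp only [RingHom.coe_coe]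
    rw [aeval_bind₁]
    congr 2
    funext i
    simp [Fin.sum_univ_four, T, mul_comm]
  have hGe : ∀ x y z w : k, eval ![x, y, z, w] G = eval (x • v0 + y • v1 + z • v2 + w • v3) F :=
    hbind F
  have hGd : ∀ (j : Fin 4) (x y z w : k), eval ![x, y, z, w] (pderiv j G) =
      ∑ i, T j i * eval (x • v0 + y • v1 + z • v2 + w • v3) (pderiv i F) := by
    intro j x y z w
    simp only [G]
    rw [chain_rule, map_sum]
    apply Finset.sum_congr rfl
    intro i _
    rw [map_mul, eval_C, hbind]
  clear_value G T
  have hGsm : ∀ x y z w : k, (x ≠ 0 ∨ y ≠ 0 ∨ z ≠ 0 ∨ w ≠ 0) → eval ![x, y, z, w] G = 0 →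
      eval ![x, y, z, w] (pderiv 0 G) = 0 → eval ![x, y, z, w] (pderiv 1 G) = 0 →
      eval ![x, y, z, w] (pderiv 2 G) = 0 → eval ![x, y, z, w] (pderiv 3 G) = 0 → False := by
    intro x y z w hne e0 d0 d1 d2 d3
    refine hsm (x • v0 + y • v1 + z • v2 + w • v3) ?_ ⟨(hGe x y z w).symm.trans e0, ?_⟩
    · intro h
      have := hinj _ _ _ _ h
      tauto
    · have := hTinj (fun i => eval (x • v0 + y • v1 + z • v2 + w • v3) (pderiv i F)) (by
        intro j
        rw [← hGd]
        match j with
        | 0 => exact d0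
        | 1 => exact d1
        | 2 => exact d2
        | 3 => exact d3)
      intro i
      exact congrFun this i
  obtain ⟨p, q, r, s, e, f, g, hE, hD0, hD1, hD2, hD3⟩ := quartic_form G hGhom
    (fun x y => by
      rw [hGe]; apply hl₁X
      simpa using l₁.add_mem (l₁.smul_mem x hv0) (l₁.smul_mem y hv1))
    (fun z w => by
      rw [hGe]; apply hl₂X
      simpa using l₂.add_mem (l₂.smul_mem z hv2) (l₂.smul_mem w hv3))
  have hpq : ∀ x y, (x ≠ 0 ∨ y ≠ 0) → cub p x y ≠ 0 ∨ cub q x y ≠ 0 := by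
    intro x y hxy
    by_contra hcon
    push Not at hcon
    refine hGsm x y 0 0 (by tauto) ?_ ?_ ?_ ?_ ?_
    · rw [hE]; simp [cub]
    · rw [hD0]; simp [cub]
    · rw [hD1]; simp [cub]
    · rw [hD2]; simp [hcon.1]
    · rw [hD3]; simp [hcon.2]
  have hform : IsForm 8 (fun x y => quad e x y * cub q x y ^ 2 + quad f x y * cub p x y * cub q x y +
      quad g x y * cub p x y ^ 2) := by
    have c3 : ∀ p : ℕ → k, IsForm 3 (cub p) := fun p => IsForm.cub p IsForm.fst IsForm.snd
    have c2 : ∀ p : ℕ → k, IsForm 2 (quad p) := fun p => IsForm.quad p IsForm.fst IsForm.snd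
    exact (((c2 e).mul ((c3 q).pow 2)).add (((c2 f).mul (c3 p)).mul (c3 q))).add ((c2 g).mul ((c3 p).pow 2))
  have hne : ∃ x y, quad e x y * cub q x y ^ 2 + quad f x y * cub p x y * cub q x y +
      quad g x y * cub p x y ^ 2 ≠ 0 := by
    by_contra hcon
    push Not at hcon
    obtain ⟨he, hf, hg⟩ := forms_zero p q e f g hpq hcon
    have e0 := he 0 (by norm_num)
    have e1 := he 1 (by norm_num)
    have e2 := he 2 (by norm_num)
    have f0 := hf 0 (by norm_num)
    have f1 := hf 1 (by norm_num)
    have f2 := hf 2 (by norm_num)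
    have g0 := hg 0 (by norm_num)
    have g1 := hg 1 (by norm_num)
    have g2 := hg 2 (by norm_num)
    obtain ⟨x, y, z, w, hne, k0, k1, k2, k3⟩ := sing_point p q r s
    refine hGsm x y z w hne ?_ ?_ ?_ ?_ ?_
    · rw [hE]
      simp only [quad, cub, e0, e1, e2, f0, f1, f2, g0, g1, g2] at k0 k1 ⊢
      linear_combination x * k0 + y * k1
    · rw [hD0]
      simp only [quad, e0, e1, e2, f0, f1, f2, g0, g1, g2, h2, h3]
      linear_combination k0
    · rw [hD1]
      simp only [quad, e0, e1, e2, f0, f1, f2, g0, g1, g2, h2, h3]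
      linear_combination k1
    · rw [hD2]
      simp only [quad, e0, e1, e2, f0, f1, f2, g0, g1, g2, h2, h3]
      linear_combination k2
    · rw [hD3]
      simp only [quad, e0, e1, e2, f0, f1, f2, g0, g1, g2, h2, h3]
      linear_combination k3
  obtain ⟨S, hS, hroot⟩ := hform.root_count hne
  classical
  let L : k × k → Submodule k (Fin 4 → k) := fun t =>
    Submodule.span k {t.1 • v0 + t.2 • v1, cub q t.1 t.2 • v2 + cub p t.1 t.2 • v3}
  have hsub : meetingLines F l₁ l₂ ⊆ ((S.image L : Finset _) : Set (Submodule k (Fin 4 → k))) := by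
    rintro W ⟨hW, hWX, hW1, hW2, -, -⟩
    obtain ⟨a, ⟨haW, ha⟩, ha0⟩ := Submodule.exists_mem_ne_zero_of_ne_bot hW1
    obtain ⟨b, ⟨hbW, hb⟩, hb0⟩ := Submodule.exists_mem_ne_zero_of_ne_bot hW2
    obtain ⟨x, y, rfl⟩ := hs1 a ha
    obtain ⟨z, w, rfl⟩ := hs2 b hb
    have hxy : x ≠ 0 ∨ y ≠ 0 := by
      by_contra hcon
      push Not at hcon
      apply ha0
      simp [hcon.1, hcon.2]
    have hzw : z ≠ 0 ∨ w ≠ 0 := by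
      by_contra hcon
      push Not at hcon
      apply hb0
      simp [hcon.1, hcon.2]
    have hzero : ∀ τ : k, τ * (z * cub p x y + w * cub q x y) +
        τ ^ 2 * (z ^ 2 * quad e x y + z * w * quad f x y + w ^ 2 * quad g x y) +
        τ ^ 3 * (x * cub r z w + y * cub s z w) = 0 := by
      intro τ
      have h := hWX _ (W.add_mem haW (W.smul_mem τ hbW))
      have h' : eval ![x, y, τ * z, τ * w] G = 0 := by
        rw [hGe, ← h]
        congr 2
        simp only [smul_add, smul_smul, add_assoc]
      rw [hE] at h'
      simp only [cub] at h' ⊢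
      linear_combination h'
    have hpoly : ∀ A B D : k, (∀ τ : k, τ * A + τ ^ 2 * B + τ ^ 3 * D = 0) → A = 0 ∧ B = 0 := by
      intro A B D h
      have hp : Polynomial.C A * Polynomial.X + Polynomial.C B * Polynomial.X ^ 2 +
          Polynomial.C D * Polynomial.X ^ 3 = 0 := by
        apply Polynomial.funext
        intro τ
        have := h τ
        simp
        linear_combination this
      have c1 := congrArg (fun P => Polynomial.coeff P 1) hp
      have c2 := congrArg (fun P => Polynomial.coeff P 2) hp
      simp [Polynomial.coeff_X, Polynomial.coeff_X_pow] at c1 c2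
      exact ⟨c1, c2⟩
    obtain ⟨hA, hB⟩ := hpoly _ _ _ hzero
    have hd : ∃ d : k, z = d * cub q x y ∧ w = d * cub p x y := by
      rcases hpq x y hxy with h | h
      · refine ⟨w / cub p x y, ?_, by field_simp⟩
        field_simp
        linear_combination hA - w * cub q x y * h2
      · refine ⟨z / cub q x y, by field_simp, ?_⟩
        field_simp
        linear_combination hA - z * cub p x y * h2
    obtain ⟨d, hz, hw⟩ := hd
    have hd0 : d ≠ 0 := by
      rintro rfl
      simp at hz hw
      tauto
    have hGxy : quad e x y * cub q x y ^ 2 + quad f x y * cub p x y * cub q x y +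
        quad g x y * cub p x y ^ 2 = 0 := by
      rw [hz, hw] at hB
      apply mul_left_cancel₀ (pow_ne_zero 2 hd0)
      linear_combination hB
    obtain ⟨t, htS, c, hc0, hx, hy⟩ := hroot x y hxy hGxy
    rw [Finset.coe_image]
    refine ⟨t, htS, ?_⟩
    symm
    have m1 : x • v0 + y • v1 = c • (t.1 • v0 + t.2 • v1) := by
      rw [smul_add, smul_smul, smul_smul, hx, hy]
    have m2 : z • v2 + w • v3 = (d * c ^ 3) • (cub q t.1 t.2 • v2 + cub p t.1 t.2 • v3) := by
      rw [smul_add, smul_smul, smul_smul, hz, hw, hx, hy]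
      simp only [cub]
      congr 2 <;> ring
    rw [m1] at haW ha0 ha
    rw [m2] at hbW hb0 hb
    have hdc : d * c ^ 3 ≠ 0 := mul_ne_zero hd0 (pow_ne_zero 3 hc0)
    exact eq_span hdisj hW ((l₁.smul_mem_iff hc0).mp ha) ((l₂.smul_mem_iff hdc).mp hb)
      (right_ne_zero_of_smul ha0) (right_ne_zero_of_smul hb0)
      ((W.smul_mem_iff hc0).mp haW) ((W.smul_mem_iff hdc).mp hbW)
  refine ⟨(Finset.finite_toSet _).subset hsub, ?_⟩
  refine (Set.ncard_le_ncard hsub (Finset.finite_toSet _)).trans ?_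
  rw [Set.ncard_coe_finset]
  exact Finset.card_image_le.trans hS
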